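/- arXiv:0708.1813 — 3 statements merged into one kernel-verified Lean document; each statement's English description precedes it below -/
import Mathlib

section
/- Let V be a dissipative quadratic stochastic operator on S^{m-1} with coefficients p_{ij,k}. Then for every i = 1, …, m the vector a_{ii} = (p_{ii,1}, …, p_{ii,m}) satisfies (a_{ii})↓ = e_1; that is, for each i there exists exactly one index k with p_{ii,k} = 1 and p_{ii,j} = 0 for all j ≠ k (equivalently, Ve_i is a vertex of the simplex). -/
open Finset Filter Topology

/-- Membership in the simplex `S^{m-1}`. -/
def InSimplex {m : ℕ} (x : Fin m → ℝ) : Prop :=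
  (∀ i, 0 ≤ x i) ∧ ∑ i, x i = 1

/-- The decreasing rearrangement `x↓` of a vector. -/
noncomputable def dsort {m : ℕ} (x : Fin m → ℝ) : Fin m → ℝ :=
  fun i => x (Tuple.sort x i.rev)

/-- The sum of the `k` largest coordinates of `x`. -/
noncomputable def topSum {m : ℕ} (x : Fin m → ℝ) (k : ℕ) : ℝ :=
  ∑ i ∈ Finset.univ.filter (fun i : Fin m => (i : ℕ) < k), dsort x i

/-- `Maj x y` means `x ≺ y` : `x` is majorized by `y`. -/
def Maj {m : ℕ} (x y : Fin m → ℝ) : Prop :=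
  (∀ k, 1 ≤ k → k ≤ m - 1 → topSum x k ≤ topSum y k) ∧ ∑ i, x i = ∑ i, y i

/-- The `k`-th vertex of the simplex. -/
def vertex {m : ℕ} (k : Fin m) : Fin m → ℝ := fun i => if i = k then 1 else 0

/-- The quadratic stochastic operator associated to coefficients `p`. -/
def qso {m : ℕ} (p : Fin m → Fin m → Fin m → ℝ) (x : Fin m → ℝ) : Fin m → ℝ :=
  fun k => ∑ i, ∑ j, p i j k * x i * x j

/-- Conditions on the heredity coefficients of a q.s.o. -/
def IsQSO {m : ℕ} (p : Fin m → Fin m → Fin m → ℝ) : Prop :=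
  (∀ i j k, 0 ≤ p i j k) ∧ (∀ i j k, p i j k = p j i k) ∧ (∀ i j, ∑ k, p i j k = 1)

theorem inSimplex_vertex {m : ℕ} (k : Fin m) : InSimplex (vertex k) := by
  refine ⟨fun i => ?_, by simp [vertex]⟩
  unfold vertex
  split_ifs <;> norm_num

theorem qso_vertex {m : ℕ} (p : Fin m → Fin m → Fin m → ℝ) (i : Fin m) :
    qso p (vertex i) = p i i := by
  ext k
  simp [qso, vertex]

theorem topSum_one {n : ℕ} (x : Fin (n + 1) → ℝ) :
    topSum x 1 = x (Tuple.sort x (Fin.last n)) := by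
  have h : Finset.univ.filter (fun i : Fin (n + 1) => (i : ℕ) < 1) = {0} := by
    ext i
    simp only [Finset.mem_filter, Finset.mem_univ, true_and, Finset.mem_singleton, Fin.ext_iff,
      Fin.val_zero]
    omega
  rw [topSum, h, Finset.sum_singleton, dsort, Fin.rev_zero]

theorem le_topSum_one {n : ℕ} (x : Fin (n + 1) → ℝ) (i : Fin (n + 1)) :
    x i ≤ topSum x 1 := by
  rw [topSum_one]
  simpa using Tuple.monotone_sort x (Fin.le_last ((Tuple.sort x).symm i))

/-- A point of the simplex with a coordinate at least `1` is a vertex. -/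
theorem InSimplex.eq_one_of_one_le {m : ℕ} {x : Fin m → ℝ} (hx : InSimplex x) {k : Fin m}
    (hk : 1 ≤ x k) : x k = 1 ∧ ∀ j, j ≠ k → x j = 0 := by
  obtain ⟨h0, h1⟩ := hx
  rw [← Finset.add_sum_erase _ _ (Finset.mem_univ k)] at h1
  have hs : 0 ≤ ∑ j ∈ Finset.univ.erase k, x j := Finset.sum_nonneg fun j _ => h0 j
  refine ⟨by linarith, fun j hj => ?_⟩
  have hle : x j ≤ ∑ j ∈ Finset.univ.erase k, x j :=
    Finset.single_le_sum (fun j _ => h0 j) (by simp [hj])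
  linarith [h0 j]

theorem stmt2 (m : ℕ) (p : Fin m → Fin m → Fin m → ℝ) (hp : IsQSO p)
    (hdiss : ∀ x, InSimplex x → Maj x (qso p x)) :
    ∀ i, ∃ k, p i i k = 1 ∧ ∀ j, j ≠ k → p i i j = 0 := by
  intro i
  have hsimplex : InSimplex (p i i) := ⟨hp.1 i i, hp.2.2 i i⟩
  suffices h : ∃ k, 1 ≤ p i i k from h.imp fun k hk => hsimplex.eq_one_of_one_le hk
  obtain _ | _ | n := m
  · exact i.elim0
  · exact ⟨0, by simpa using hsimplex.2.ge⟩
  · have hmaj := (hdiss _ (inSimplex_vertex i)).1 1 le_rfl (by omega)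
    rw [qso_vertex, topSum_one (p i i)] at hmaj
    have hv := le_topSum_one (vertex i) i
    exact ⟨_, (by simpa [vertex] using hv : 1 ≤ topSum (vertex i) 1).trans hmaj⟩
end

section
/- Every dissipative quadratic stochastic operator V on S^{m-1} is ergodic: for every x ∈ S^{m-1} the limit lim_{n→∞} (x + Vx + V²x + … + V^{n−1}x)/n exists. -/
open Finset Filter Topology

theorem tendsto_zero_of_eventually_periodic_sub {E : Type*} [NormedAddCommGroup E] [NormedSpace ℝ E]
    {A : ℕ → E} {N q : ℕ} (hq : 0 < q) (hA : ∀ n, N ≤ n → A (n + q) = A n) :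
    Tendsto (fun n : ℕ => (n : ℝ)⁻¹ • A n) atTop (𝓝 0) := by
  have hb : ∀ n, ‖A n‖ ≤ ∑ k ∈ Finset.range (N + q), ‖A k‖ := by
    intro n
    induction n using Nat.strong_induction_on with
    | _ n ih =>
      by_cases h : n < N + q
      · exact Finset.single_le_sum (f := fun k => ‖A k‖) (fun _ _ => norm_nonneg _)
          (Finset.mem_range.2 h)
      · have h1 := hA (n - q) (by omega)
        rw [Nat.sub_add_cancel (by omega)] at h1
        rw [h1]
        exact ih _ (by omega)
  refine squeeze_zero_norm (a := fun n : ℕ => (n : ℝ)⁻¹ * ∑ k ∈ Finset.range (N + q), ‖A k‖)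
    (fun n => ?_) ?_
  · rw [norm_smul, norm_inv, Real.norm_natCast]
    exact mul_le_mul_of_nonneg_left (hb n) (by positivity)
  · simpa using (tendsto_inv_atTop_nhds_zero_nat (𝕜 := ℝ)).mul_const
      (∑ k ∈ Finset.range (N + q), ‖A k‖)

/-- Cesàro averages of an eventually periodic sequence converge. -/
theorem exists_tendsto_cesaro_of_eventually_periodic {E : Type*} [NormedAddCommGroup E]
    [NormedSpace ℝ E] {z : ℕ → E} {N q : ℕ} (hq : 0 < q) (hz : ∀ n, N ≤ n → z (n + q) = z n) :
    ∃ L, Tendsto (fun n : ℕ => (n : ℝ)⁻¹ • ∑ k ∈ Finset.range n, z k) atTop (𝓝 L) := by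
  set S : ℕ → E := fun n => ∑ k ∈ Finset.range n, z k with hS
  set C : E := S (N + q) - S N with hC
  have hSC : ∀ n, N ≤ n → S (n + q) - S n = C := by
    intro n hn
    induction n, hn using Nat.le_induction with
    | base => rfl
    | succ n hn ih =>
      rw [← ih, show n + 1 + q = n + q + 1 by ring]
      simp only [hS, Finset.sum_range_succ, hz n hn]
      abel
  have hq' : (q : ℝ) ≠ 0 := by positivity
  have h := tendsto_zero_of_eventually_periodic_sub (A := fun n => S n - ((n : ℝ) / q) • C)
    (N := N) hq (fun n hn => by
      have h1 : ((n + q : ℕ) : ℝ) / q = (n : ℝ) / q + 1 := by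
        push_cast
        field_simp
      rw [h1, add_smul, one_smul, ← hSC n hn]
      abel)
  refine ⟨(q : ℝ)⁻¹ • C, ?_⟩
  have h2 := h.add_const ((q : ℝ)⁻¹ • C)
  rw [zero_add] at h2
  refine h2.congr' ?_
  filter_upwards [eventually_gt_atTop 0] with n hn
  have hn' : (n : ℝ) ≠ 0 := by positivity
  rw [smul_sub, smul_smul, show (n : ℝ)⁻¹ * (n / q) = (q : ℝ)⁻¹ by field_simp]
  abel

/-- If an orbit of a continuous map is asymptotic to a sequence `z` with values in a finite set,
then `z` is eventually an orbit itself. -/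
theorem eventually_orbit_of_tendsto_dist {X : Type*} [MetricSpace X] {f : X → X}
    (hf : Continuous f) {y z : ℕ → X} (hy : ∀ n, y (n + 1) = f (y n)) {F : Set X}
    (hF : F.Finite) (hz : ∀ n, z n ∈ F)
    (hyz : Tendsto (fun n => dist (y n) (z n)) atTop (𝓝 0)) :
    ∀ᶠ n in atTop, z (n + 1) = f (z n) := by
  have hfyz : Tendsto (fun n => dist (f (y n)) (f (z n))) atTop (𝓝 0) := by
    rw [Metric.tendsto_nhds]
    intro ε hε
    have key : ∀ᶠ n in atTop, ∀ w ∈ F, z n = w → dist (f (y n)) (f w) < ε := by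
      rw [hF.eventually_all]
      intro w _
      obtain ⟨δ, hδ, h⟩ := Metric.continuousAt_iff.1 (hf.continuousAt (x := w)) ε hε
      filter_upwards [hyz.eventually_lt_const hδ] with n hn hw
      exact h (hw ▸ hn)
    filter_upwards [key] with n hn
    simpa using hn _ (hz n) rfl
  have hzz : Tendsto (fun n => dist (z (n + 1)) (f (z n))) atTop (𝓝 0) := by
    refine squeeze_zero (fun _ => dist_nonneg) (fun n => ?_)
      (by simpa using ((tendsto_add_atTop_iff_nat 1).2 hyz).add hfyz)
    rw [hy, dist_comm (f (y n)) (z (n + 1))]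
    exact dist_triangle _ _ _
  have key : ∀ᶠ n in atTop, ∀ w ∈ F, ∀ w' ∈ F, z n = w → z (n + 1) = w' → w' = f w := by
    rw [hF.eventually_all]
    intro w _
    rw [hF.eventually_all]
    intro w' _
    by_cases h : w' = f w
    · exact Eventually.of_forall fun _ _ _ => h
    · filter_upwards [hzz.eventually_lt_const (dist_pos.2 h)] with n hn h1 h2
      rw [h1, h2] at hn
      exact absurd hn (lt_irrefl _)
  filter_upwards [key] with n hn
  exact hn _ (hz n) _ (hz (n + 1)) rfl rfl

/-- An orbit of a continuous map that is asymptotic to a finite set has converging Cesàro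
averages. -/
theorem exists_tendsto_cesaro_of_finite {E : Type*} [NormedAddCommGroup E] [NormedSpace ℝ E]
    {f : E → E} (hf : Continuous f) {y z : ℕ → E} (hy : ∀ n, y (n + 1) = f (y n)) {F : Set E}
    (hF : F.Finite) (hz : ∀ n, z n ∈ F) (hyz : Tendsto (fun n => y n - z n) atTop (𝓝 0)) :
    ∃ L, Tendsto (fun n : ℕ => (n : ℝ)⁻¹ • ∑ k ∈ Finset.range n, y k) atTop (𝓝 L) := by
  obtain ⟨N, hN⟩ := eventually_atTop.1 (eventually_orbit_of_tendsto_dist hf hy hF hz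
    (by simpa [dist_eq_norm] using hyz.norm))
  obtain ⟨a, -, b, -, hab, heq⟩ := Set.infinite_univ.exists_lt_map_eq_of_mapsTo
    (f := fun n => z (N + n)) (t := F) (fun n _ => hz _) hF
  have hper : ∀ n, N + a ≤ n → z (n + (b - a)) = z n := by
    intro n hn
    induction n, hn using Nat.le_induction with
    | base => rw [show N + a + (b - a) = N + b by omega]; exact heq.symm
    | succ n hn ih =>
      rw [show n + 1 + (b - a) = n + (b - a) + 1 by ring, hN _ (by omega), hN n (by omega), ih]
  obtain ⟨L, hL⟩ := exists_tendsto_cesaro_of_eventually_periodic (Nat.sub_pos_of_lt hab) hper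
  refine ⟨L, ?_⟩
  have h := hyz.cesaro_smul.add hL
  rw [zero_add] at h
  refine h.congr fun n => ?_
  rw [← smul_add, ← Finset.sum_add_distrib]
  simp

theorem continuous_qso {m : ℕ} (p : Fin m → Fin m → Fin m → ℝ) : Continuous (qso p) := by
  unfold qso
  fun_prop

theorem InSimplex.qso {m : ℕ} {p : Fin m → Fin m → Fin m → ℝ} (hp : IsQSO p) {x : Fin m → ℝ}
    (hx : InSimplex x) : InSimplex (qso p x) := by
  refine ⟨fun k => Finset.sum_nonneg fun i _ => Finset.sum_nonneg fun j _ =>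
    mul_nonneg (mul_nonneg (hp.1 i j k) (hx.1 i)) (hx.1 j), ?_⟩
  have h : ∑ k, _root_.qso p x k = ∑ i, ∑ j, x i * x j := by
    unfold _root_.qso
    rw [Finset.sum_comm]
    refine Finset.sum_congr rfl fun i _ => ?_
    rw [Finset.sum_comm]
    refine Finset.sum_congr rfl fun j _ => ?_
    simp_rw [mul_assoc]
    rw [← Finset.sum_mul, hp.2.2, one_mul]
  rw [h, ← Finset.sum_mul_sum, hx.2, one_mul]

/-- The permutation that rearranges `x` into decreasing order. -/
noncomputable def dsortPerm {m : ℕ} (x : Fin m → ℝ) : Equiv.Perm (Fin m) :=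
  Fin.revPerm.trans (Tuple.sort x)

theorem dsort_eq_comp {m : ℕ} (x : Fin m → ℝ) : dsort x = x ∘ dsortPerm x := rfl

theorem sum_dsort {m : ℕ} (x : Fin m → ℝ) : ∑ i, dsort x i = ∑ i, x i := by
  rw [dsort_eq_comp]
  exact Equiv.sum_comp (dsortPerm x) x

theorem topSum_succ {m : ℕ} (x : Fin m → ℝ) (i : Fin m) :
    topSum x (i + 1) = topSum x i + dsort x i := by
  unfold topSum
  rw [show Finset.univ.filter (fun j : Fin m => (j : ℕ) < i + 1)
      = insert i (Finset.univ.filter fun j : Fin m => (j : ℕ) < i) by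
    ext j; simp [Fin.ext_iff]; omega]
  rw [Finset.sum_insert (by simp), add_comm]

theorem topSum_of_le {m k : ℕ} (x : Fin m → ℝ) (hk : m ≤ k) : topSum x k = ∑ i, x i := by
  rw [← sum_dsort, topSum, Finset.filter_true_of_mem]
  intro i _
  omega

theorem Maj.topSum_le {m : ℕ} {x y : Fin m → ℝ} (h : Maj x y) (k : ℕ) :
    topSum x k ≤ topSum y k := by
  rcases Nat.eq_zero_or_pos k with rfl | hk
  · simp [topSum]
  · by_cases hkm : m ≤ k
    · rw [topSum_of_le x hkm, topSum_of_le y hkm, h.2]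
    · exact h.1 k hk (by omega)

theorem InSimplex.topSum_le_one {m : ℕ} {x : Fin m → ℝ} (hx : InSimplex x) (k : ℕ) :
    topSum x k ≤ 1 := by
  rw [← hx.2, ← sum_dsort]
  exact Finset.sum_le_sum_of_subset_of_nonneg (Finset.filter_subset _ _)
    fun i _ _ => hx.1 _

/-- Decreasing rearrangements converge along a majorization-increasing sequence. -/
theorem exists_tendsto_dsort {m : ℕ} {y : ℕ → Fin m → ℝ} (hy : ∀ n, InSimplex (y n))
    (hmaj : ∀ n, Maj (y n) (y (n + 1))) :
    ∃ c, Tendsto (fun n => dsort (y n)) atTop (𝓝 c) := by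
  have h : ∀ k, ∃ l, Tendsto (fun n => topSum (y n) k) atTop (𝓝 l) := fun k =>
    ⟨_, tendsto_atTop_ciSup (monotone_nat_of_le_succ fun n => (hmaj n).topSum_le k)
      ⟨1, by rintro _ ⟨n, rfl⟩; exact (hy n).topSum_le_one k⟩⟩
  choose l hl using h
  refine ⟨fun i => l (i + 1) - l i, tendsto_pi_nhds.2 fun i => ?_⟩
  refine ((hl (i + 1)).sub (hl i)).congr fun n => ?_
  rw [topSum_succ]
  ring

theorem stmt16 (m : ℕ) (p : Fin m → Fin m → Fin m → ℝ) (hp : IsQSO p)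
    (hdiss : ∀ x, InSimplex x → Maj x (qso p x)) :
    ∀ x, InSimplex x → ∃ L : Fin m → ℝ,
      Tendsto (fun n : ℕ => (n : ℝ)⁻¹ • ∑ k ∈ Finset.range n, (qso p)^[k] x)
        atTop (𝓝 L) := by
  intro x hx
  have hsucc : ∀ n, (qso p)^[n + 1] x = qso p ((qso p)^[n] x) :=
    fun n => Function.iterate_succ_apply' _ _ _
  have hmem : ∀ n, InSimplex ((qso p)^[n] x) := by
    intro n
    induction n with
    | zero => exact hx
    | succ n ih => rw [hsucc]; exact ih.qso hp
  obtain ⟨c, hc⟩ := exists_tendsto_dsort hmem fun n => by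
    rw [hsucc]; exact hdiss _ (hmem n)
  refine exists_tendsto_cesaro_of_finite (continuous_qso p) hsucc
    (z := fun n => c ∘ (dsortPerm ((qso p)^[n] x)).symm)
    (Set.finite_range fun σ : Equiv.Perm (Fin m) => c ∘ σ) (fun n => ⟨_, rfl⟩) ?_
  refine squeeze_zero_norm (fun n => ?_) (by simpa using (hc.sub_const c).norm)
  refine (pi_norm_le_iff_of_nonneg (norm_nonneg _)).2 fun j => ?_
  have h := norm_le_pi_norm (dsort ((qso p)^[n] x) - c) ((dsortPerm ((qso p)^[n] x)).symm j)
  simpa [dsort_eq_comp] using h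
end

section
/- Let V be a dissipative cubic stochastic operator on S^{m-1} with coefficients p_{ijl,k}, and suppose p_{jjj,k_0} = 1 for some indices j and k_0. Then for every i = 1, …, m one has p_{ijj,k_0} ≥ 2/3, p_{ijj,k_0} is the largest coordinate of the vector a_{ijj} = (p_{ijj,1}, …, p_{ijj,m}), and a_{ijj} has at most two nonzero coordinates (its third-largest coordinate is 0). -/
open Finset Filter Topology

/-- The cubic stochastic operator associated to coefficients `p`. -/
def cso {m : ℕ} (p : Fin m → Fin m → Fin m → Fin m → ℝ) (x : Fin m → ℝ) : Fin m → ℝ :=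
  fun k => ∑ i, ∑ j, ∑ l, p i j l k * x i * x j * x l

/-- Conditions on the heredity coefficients of a c.s.o. -/
def IsCSO {m : ℕ} (p : Fin m → Fin m → Fin m → Fin m → ℝ) : Prop :=
  (∀ i j l k, 0 ≤ p i j l k) ∧ (∀ i j l k, p i j l k = p j i l k) ∧
    (∀ i j l k, p i j l k = p i l j k) ∧ (∀ i j l, ∑ k, p i j l k = 1)

/-- The indices of `k` largest coordinates of `x`. -/
noncomputable def topIndices {m : ℕ} (x : Fin m → ℝ) (k : ℕ) : Finset (Fin m) :=
  (Finset.univ.filter (fun i : Fin m => (i : ℕ) < k)).map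
    (Fin.revPerm.trans (Tuple.sort x)).toEmbedding

theorem topSum_eq_sum_topIndices {m : ℕ} (x : Fin m → ℝ) (k : ℕ) :
    topSum x k = ∑ i ∈ topIndices x k, x i := by
  simp [topSum, topIndices, dsort]

theorem card_topIndices {m : ℕ} (x : Fin m → ℝ) {k : ℕ} (hk : k ≤ m) :
    (topIndices x k).card = k := by
  rw [topIndices, Finset.card_map, Fin.card_filter_val_lt, min_eq_right hk]

theorem le_of_mem_topIndices_of_notMem {m : ℕ} (x : Fin m → ℝ) {k : ℕ} {s t : Fin m}
    (hs : s ∉ topIndices x k) (ht : t ∈ topIndices x k) : x s ≤ x t := by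
  obtain ⟨a, rfl⟩ := (Fin.revPerm.trans (Tuple.sort x)).surjective s
  obtain ⟨b, rfl⟩ := (Fin.revPerm.trans (Tuple.sort x)).surjective t
  have ha : k ≤ (a : ℕ) := by simpa [topIndices] using hs
  have hb : (b : ℕ) < k := by simpa [topIndices] using ht
  have hab : a.rev ≤ b.rev := Fin.rev_le_rev.2 (Fin.le_def.2 (by omega))
  exact Tuple.monotone_sort x hab

theorem sum_le_topSum {m : ℕ} (x : Fin m → ℝ) (s : Finset (Fin m)) :
    ∑ i ∈ s, x i ≤ topSum x s.card := by
  rw [topSum_eq_sum_topIndices]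
  set T := topIndices x s.card with hT
  have hcard : T.card = s.card :=
    card_topIndices x (by simpa using Finset.card_le_univ s)
  have hsdiff : (s \ T).card = (T \ s).card := Finset.card_sdiff_comm hcard.symm
  rw [← Finset.sum_sdiff_le_sum_sdiff]
  rcases (T \ s).eq_empty_or_nonempty with h | h
  · have h' : s \ T = ∅ := by rw [← Finset.card_eq_zero, hsdiff, h, Finset.card_empty]
    rw [h, h']
  · obtain ⟨t, ht, hmin⟩ := Finset.exists_min_image (T \ s) x h
    calc ∑ i ∈ s \ T, x i ≤ (s \ T).card • x t :=
          Finset.sum_le_card_nsmul _ _ _ fun i hi =>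
            le_of_mem_topIndices_of_notMem x (Finset.mem_sdiff.1 hi).2 (Finset.mem_sdiff.1 ht).1
      _ = (T \ s).card • x t := by rw [hsdiff]
      _ ≤ ∑ i ∈ T \ s, x i := Finset.card_nsmul_le_sum _ _ _ hmin

theorem exists_card_eq_sum_le_of_maj {m : ℕ} {x y : Fin m → ℝ} (h : Maj x y)
    {s : Finset (Fin m)} (hs : s.Nonempty) (hsm : s.card < m) :
    ∃ T : Finset (Fin m), T.card = s.card ∧ ∑ i ∈ s, x i ≤ ∑ i ∈ T, y i := by
  refine ⟨topIndices y s.card, card_topIndices y hsm.le, ?_⟩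
  rw [← topSum_eq_sum_topIndices]
  exact (sum_le_topSum x s).trans (h.1 _ hs.card_pos (by omega))

/-- The point `(1 - ε) e_j + ε e_i` of the edge between two vertices. -/
def edgePoint {m : ℕ} (i j : Fin m) (ε : ℝ) : Fin m → ℝ :=
  fun t => (1 - ε) * vertex j t + ε * vertex i t

theorem sum_mul_edgePoint {m : ℕ} (i j : Fin m) (ε : ℝ) (f : Fin m → ℝ) :
    ∑ t, f t * edgePoint i j ε t = f j * (1 - ε) + f i * ε := by
  simp [edgePoint, vertex, mul_add, Finset.sum_add_distrib]

theorem inSimplex_edgePoint {m : ℕ} (i j : Fin m) {ε : ℝ} (h0 : 0 ≤ ε) (h1 : ε ≤ 1) :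
    InSimplex (edgePoint i j ε) := by
  constructor
  · intro t
    have h2 : 0 ≤ 1 - ε := by linarith
    unfold edgePoint vertex
    split_ifs <;> simp <;> linarith
  · simpa using sum_mul_edgePoint i j ε fun _ => 1

theorem cso_edgePoint {m : ℕ} {p : Fin m → Fin m → Fin m → Fin m → ℝ} (hp : IsCSO p)
    (i j : Fin m) (ε : ℝ) (k : Fin m) :
    cso p (edgePoint i j ε) k = (1 - ε) ^ 3 * p j j j k + 3 * (1 - ε) ^ 2 * ε * p i j j k +
      3 * (1 - ε) * ε ^ 2 * p i i j k + ε ^ 3 * p i i i k := by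
  obtain ⟨-, h12, h23, -⟩ := hp
  have e1 : ∀ a b, ∑ l, p a b l k * edgePoint i j ε a * edgePoint i j ε b * edgePoint i j ε l =
      (p a b j k * (1 - ε) + p a b i k * ε) * edgePoint i j ε a * edgePoint i j ε b := by
    intro a b
    rw [sum_mul_edgePoint i j ε fun l => p a b l k * edgePoint i j ε a * edgePoint i j ε b]
    ring
  simp only [cso, e1]
  have e2 : ∀ a, ∑ b, (p a b j k * (1 - ε) + p a b i k * ε) * edgePoint i j ε a *
      edgePoint i j ε b = ((p a j j k * (1 - ε) + p a j i k * ε) * (1 - ε) +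
        (p a i j k * (1 - ε) + p a i i k * ε) * ε) * edgePoint i j ε a := by
    intro a
    rw [sum_mul_edgePoint i j ε fun b =>
      (p a b j k * (1 - ε) + p a b i k * ε) * edgePoint i j ε a]
    ring
  simp only [e2]
  rw [sum_mul_edgePoint i j ε fun a => (p a j j k * (1 - ε) + p a j i k * ε) * (1 - ε) +
        (p a i j k * (1 - ε) + p a i i k * ε) * ε]
  rw [h23 j j i k, h12 j i j k, h12 j i i k, h23 i j i k]
  ring

theorem IsCSO.add_le_one {m : ℕ} {p : Fin m → Fin m → Fin m → Fin m → ℝ} (hp : IsCSO p)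
    (a b c : Fin m) {s t : Fin m} (hst : s ≠ t) : p a b c s + p a b c t ≤ 1 := by
  rw [← hp.2.2.2 a b c, ← Finset.sum_pair hst]
  exact Finset.sum_le_sum_of_subset_of_nonneg (Finset.subset_univ _) fun k _ _ => hp.1 a b c k

theorem IsCSO.le_one {m : ℕ} {p : Fin m → Fin m → Fin m → Fin m → ℝ} (hp : IsCSO p)
    (a b c k : Fin m) : p a b c k ≤ 1 := by
  rw [← hp.2.2.2 a b c]
  exact Finset.single_le_sum (fun k _ => hp.1 a b c k) (Finset.mem_univ k)

theorem cso_edgePoint_nonneg {m : ℕ} {p : Fin m → Fin m → Fin m → Fin m → ℝ} (hp : IsCSO p)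
    (i j : Fin m) {ε : ℝ} (h0 : 0 ≤ ε) (h1 : ε ≤ 1) (k : Fin m) :
    0 ≤ cso p (edgePoint i j ε) k := by
  have hx := (inSimplex_edgePoint i j h0 h1).1
  exact Finset.sum_nonneg fun a _ => Finset.sum_nonneg fun b _ => Finset.sum_nonneg fun c _ =>
    mul_nonneg (mul_nonneg (mul_nonneg (hp.1 a b c k) (hx a)) (hx b)) (hx c)

theorem one_sub_le_cso_edgePoint {m : ℕ} {p : Fin m → Fin m → Fin m → Fin m → ℝ}
    (hp : IsCSO p) (hdiss : ∀ x, InSimplex x → Maj x (cso p x)) {i j k0 : Fin m}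
    (hjjj : p j j j k0 = 1) (hij : i ≠ j) {ε : ℝ} (h0 : 0 ≤ ε) (h1 : ε ≤ 1 / 4) :
    1 - ε ≤ cso p (edgePoint i j ε) k0 := by
  have hε : ε ≤ 1 := by linarith
  have hS := inSimplex_edgePoint i j h0 hε
  have hmaj := hdiss _ hS
  have hm : 1 < m := by
    simpa using Fintype.one_lt_card_iff.2 ⟨i, j, hij⟩
  obtain ⟨T, hT, hle⟩ := exists_card_eq_sum_le_of_maj hmaj (Finset.singleton_nonempty j)
    (by simpa using hm)
  obtain ⟨t, rfl⟩ := Finset.card_eq_one.1 (by simpa using hT)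
  have hxj : edgePoint i j ε j = 1 - ε := by simp [edgePoint, vertex, hij.symm]
  rw [Finset.sum_singleton, Finset.sum_singleton, hxj] at hle
  by_cases htk : t = k0
  · rwa [← htk]
  · exfalso
    have hsum : cso p (edgePoint i j ε) t + cso p (edgePoint i j ε) k0 ≤ 1 := by
      rw [← hS.2, hmaj.2, ← Finset.sum_pair htk]
      exact Finset.sum_le_sum_of_subset_of_nonneg (Finset.subset_univ _)
        fun k _ _ => cso_edgePoint_nonneg hp i j h0 hε k
    have hk0 : (1 - ε) ^ 3 ≤ cso p (edgePoint i j ε) k0 := by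
      rw [cso_edgePoint hp, hjjj]
      have h2 : 0 ≤ 1 - ε := by linarith
      have := hp.1 i j j k0
      have := hp.1 i i j k0
      have := hp.1 i i i k0
      have : 0 ≤ 3 * (1 - ε) ^ 2 * ε * p i j j k0 + 3 * (1 - ε) * ε ^ 2 * p i i j k0 +
        ε ^ 3 * p i i i k0 := by positivity
      linarith
    have hcube : (3 / 4 : ℝ) ^ 3 ≤ (1 - ε) ^ 3 :=
      pow_le_pow_left₀ (by norm_num) (by linarith) 3
    norm_num at hcube
    linarith

theorem two_thirds_le_of_dissipative {m : ℕ} {p : Fin m → Fin m → Fin m → Fin m → ℝ}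
    (hp : IsCSO p) (hdiss : ∀ x, InSimplex x → Maj x (cso p x)) {i j k0 : Fin m}
    (hjjj : p j j j k0 = 1) (hij : i ≠ j) : 2 / 3 ≤ p i j j k0 := by
  by_contra! ha
  obtain ⟨ε, h0, h1, h2⟩ : ∃ ε : ℝ, 0 < ε ∧ ε ≤ 1 / 4 ∧ ε ≤ (2 - 3 * p i j j k0) / 8 :=
    ⟨min (1 / 4) ((2 - 3 * p i j j k0) / 8), lt_min (by norm_num) (by linarith),
      min_le_left _ _, min_le_right _ _⟩
  have hle := one_sub_le_cso_edgePoint hp hdiss hjjj hij h0.le h1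
  rw [cso_edgePoint hp, hjjj] at hle
  have ha0 := hp.1 i j j k0
  have hb : (1 - ε) * p i i j k0 ≤ 1 :=
    mul_le_one₀ (by linarith) (hp.1 _ _ _ _) (hp.le_one _ _ _ _)
  have hc := hp.le_one i i i k0
  have hsq : (1 - ε) ^ 2 * p i j j k0 ≤ p i j j k0 :=
    mul_le_of_le_one_left ha0 (pow_le_one₀ (by linarith) (by linarith))
  have hdiv : ε * 2 ≤ ε * (3 * ε - ε ^ 2 + 3 * ((1 - ε) ^ 2 * p i j j k0) +
      3 * ε * ((1 - ε) * p i i j k0) + ε ^ 2 * p i i i k0) := by linarith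
  have hdiv' := le_of_mul_le_mul_left hdiv h0
  have hb' := mul_le_mul_of_nonneg_left hb h0.le
  have hc' := mul_le_mul_of_nonneg_left hc (sq_nonneg ε)
  linarith

theorem exists_support_subset_pair_of_dissipative {m : ℕ}
    {p : Fin m → Fin m → Fin m → Fin m → ℝ}
    (hp : IsCSO p) (hdiss : ∀ x, InSimplex x → Maj x (cso p x)) {i j k0 : Fin m}
    (hjjj : p j j j k0 = 1) (hij : i ≠ j) :
    ∃ k', ∀ t, t ≠ k0 → t ≠ k' → p i j j t = 0 := by
  obtain ⟨T, hT, hzero⟩ : ∃ T : Finset (Fin m), T.card ≤ 2 ∧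
      ∀ t ∉ T, cso p (edgePoint i j (1 / 4)) t = 0 := by
    by_cases hm : 2 < m
    · have hS := inSimplex_edgePoint i j (ε := 1 / 4) (by norm_num) (by norm_num)
      have hmaj := hdiss _ hS
      have hcard : ({i, j} : Finset (Fin m)).card = 2 := Finset.card_pair hij
      obtain ⟨T, hT, hle⟩ := exists_card_eq_sum_le_of_maj hmaj
        (Finset.insert_nonempty i {j}) (by omega)
      refine ⟨T, by omega, fun t ht => ?_⟩
      have hx : ∑ s ∈ {i, j}, edgePoint i j (1 / 4) s = 1 := by
        rw [Finset.sum_pair hij]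
        simp [edgePoint, vertex, hij, hij.symm]
      have htot := hmaj.2
      rw [hS.2] at htot
      have hnn := cso_edgePoint_nonneg hp i j (ε := 1 / 4) (by norm_num) (by norm_num)
      have hins : ∑ s ∈ insert t T, cso p (edgePoint i j (1 / 4)) s ≤ 1 := by
        refine le_of_le_of_eq ?_ htot.symm
        exact Finset.sum_le_sum_of_subset_of_nonneg (Finset.subset_univ _) fun k _ _ => hnn k
      rw [Finset.sum_insert ht] at hins
      linarith [hnn t]
    · exact ⟨Finset.univ, by simpa using hm, fun t ht => absurd (Finset.mem_univ t) ht⟩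
  have hpzero : ∀ t ∉ T, p i j j t = 0 := by
    intro t ht
    have h := hzero t ht
    rw [cso_edgePoint hp] at h
    linarith [hp.1 j j j t, hp.1 i j j t, hp.1 i i j t, hp.1 i i i t]
  have hk0 : k0 ∈ T := by
    by_contra h
    have h1 := hzero k0 h
    have h2 := one_sub_le_cso_edgePoint hp hdiss hjjj hij (ε := 1 / 4) (by norm_num) le_rfl
    linarith
  have herase : (T.erase k0).card ≤ 1 := by
    rw [Finset.card_erase_of_mem hk0]
    omega
  rcases (T.erase k0).eq_empty_or_nonempty with h | ⟨k', hk'⟩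
  · refine ⟨k0, fun t ht _ => hpzero t fun htT => ?_⟩
    exact Finset.notMem_empty t (h ▸ Finset.mem_erase.2 ⟨ht, htT⟩)
  · exact ⟨k', fun t ht ht' => hpzero t fun htT =>
      ht' (Finset.card_le_one.1 herase t (Finset.mem_erase.2 ⟨ht, htT⟩) k' hk')⟩

theorem stmt18 (m : ℕ) (p : Fin m → Fin m → Fin m → Fin m → ℝ) (hp : IsCSO p)
    (hdiss : ∀ x, InSimplex x → Maj x (cso p x))
    (j k0 : Fin m) (hjjj : p j j j k0 = 1) :
    ∀ i, (2 : ℝ) / 3 ≤ p i j j k0 ∧ (∀ t, p i j j t ≤ p i j j k0) ∧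
      ∃ k', ∀ t, t ≠ k0 → t ≠ k' → p i j j t = 0 := by
  have hmax : ∀ i, (2 : ℝ) / 3 ≤ p i j j k0 → ∀ t, p i j j t ≤ p i j j k0 := by
    intro i hi t
    rcases eq_or_ne t k0 with rfl | ht
    · exact le_rfl
    · linarith [hp.add_le_one i j j ht]
  intro i
  by_cases hij : i = j
  · subst hij
    have hi : (2 : ℝ) / 3 ≤ p i i i k0 := by rw [hjjj]; norm_num
    exact ⟨hi, hmax i hi, k0, fun t ht _ =>
      le_antisymm (by linarith [hp.add_le_one i i i ht]) (hp.1 i i i t)⟩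
  · have hi := two_thirds_le_of_dissipative hp hdiss hjjj hij
    exact ⟨hi, hmax i hi, exists_support_subset_pair_of_dissipative hp hdiss hjjj hij⟩
end
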